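/- Let G be a group and let σ_1, …, σ_{2m−1} ∈ G satisfy the braid relations. Then for every i with 1 ≤ i ≤ m−1, the element Θ_m satisfies the block-shift identity σ_i Θ_m = Θ_m σ_{m+i}. -/

import Mathlib

/-- `PiUp σ m i = σ (m+1) * σ (m+2) * ⋯ * σ (m+i)`. -/
def PiUp {G : Type*} [Group G] (σ : ℕ → G) (m i : ℕ) : G :=
  ((List.range i).map (fun k => σ (m + 1 + k))).prod

/-- `PiDown σ m i = σ (m-1) * σ (m-2) * ⋯ * σ (m-i)`. -/
def PiDown {G : Type*} [Group G] (σ : ℕ → G) (m i : ℕ) : G :=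
  ((List.range i).map (fun k => σ (m - 1 - k))).prod

/-- `DeltaUp σ m = Π^m_{m-1} * Π^m_{m-2} * ⋯ * Π^m_1`. -/
def DeltaUp {G : Type*} [Group G] (σ : ℕ → G) (m : ℕ) : G :=
  ((List.range (m - 1)).map (fun k => PiUp σ m (m - 1 - k))).prod

/-- `DeltaDown σ m = Π′^m_{m-1} * Π′^m_{m-2} * ⋯ * Π′^m_1`. -/
def DeltaDown {G : Type*} [Group G] (σ : ℕ → G) (m : ℕ) : G :=
  ((List.range (m - 1)).map (fun k => PiDown σ m (m - 1 - k))).prod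

/-- `Theta σ m = σ m · Π′^m_{m-1} · Π^m_{m-1} · σ m · Π′^m_{m-2} · Π^m_{m-2} ⋯ σ m · Π′^m_1 · Π^m_1 · σ m`. -/
def Theta {G : Type*} [Group G] (σ : ℕ → G) (m : ℕ) : G :=
  σ m * ((List.range (m - 1)).map
    (fun k => PiDown σ m (m - 1 - k) * PiUp σ m (m - 1 - k) * σ m)).prod

/-- The product of the braid word given by a list of letters `(i, ε)`,
where `(i, true)` stands for `σ i` and `(i, false)` for `σ i ⁻¹`. -/
def wordProd {G : Type*} [Group G] (σ : ℕ → G) (w : List (ℕ × Bool)) : G :=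
  (w.map (fun p => if p.2 then σ p.1 else (σ p.1)⁻¹)).prod

/-- In a braid-like sequence `s`, the product `s 0 * ⋯ * s n` conjugates `s j` to `s (j + 1)`. -/
theorem semiconjBy_prod_range_of_braid {G : Type*} [Group G] {s : ℕ → G} {n j : ℕ}
    (hc : ∀ i j, j ≤ n → i + 2 ≤ j → Commute (s i) (s j))
    (hb : ∀ i, i + 1 ≤ n → s i * s (i + 1) * s i = s (i + 1) * s i * s (i + 1)) (hj : j < n) :
    SemiconjBy ((List.range (n + 1)).map s).prod (s j) (s (j + 1)) := by
  induction n with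
  | zero => omega
  | succ n ih =>
    rw [List.range_succ, List.map_append, List.prod_append, List.map_singleton,
      List.prod_singleton]
    rcases Nat.lt_succ_iff_lt_or_eq.mp hj with h | rfl
    · exact (ih (fun i j hj => hc i j (by omega)) (fun i hi => hb i (by omega)) h).mul_left
        (hc j (n + 1) le_rfl (by omega)).symm
    · rw [List.range_succ, List.map_append, List.prod_append, List.map_singleton,
        List.prod_singleton, mul_assoc]
      refine SemiconjBy.mul_left (y := s (j + 1)) ?_ ?_
      · refine (Commute.list_prod_right _ _ fun x hx => ?_).symm
        obtain ⟨k, hk, rfl⟩ := List.mem_map.mp hx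
        exact (hc k (j + 1) le_rfl (by have := List.mem_range.mp hk; omega)).symm
      · rw [SemiconjBy, ← mul_assoc, ← hb j le_rfl]

/-- In a braid-like sequence `s`, `s 0 * ⋯ * s n` conjugates `s 0 * ⋯ * s (n - 1)` to
`s 1 * ⋯ * s n`. -/
theorem semiconjBy_prod_range_prod_range_of_braid {G : Type*} [Group G] {s : ℕ → G} {n : ℕ}
    (hc : ∀ i j, j ≤ n → i + 2 ≤ j → Commute (s i) (s j))
    (hb : ∀ i, i + 1 ≤ n → s i * s (i + 1) * s i = s (i + 1) * s i * s (i + 1)) :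
    SemiconjBy ((List.range (n + 1)).map s).prod ((List.range n).map s).prod
      ((List.range n).map fun k => s (k + 1)).prod := by
  have key : ∀ k ≤ n, SemiconjBy ((List.range (n + 1)).map s).prod ((List.range k).map s).prod
      ((List.range k).map fun k => s (k + 1)).prod := by
    intro k hk
    induction k with
    | zero => exact SemiconjBy.one_right _
    | succ k ih =>
      simp only [List.range_succ (n := k), List.map_append, List.prod_append, List.map_singleton,
        List.prod_singleton]
      exact (ih (by omega)).mul_right (semiconjBy_prod_range_of_braid hc hb hk)
  exact key n le_rfl

theorem mul_PiDown {G : Type*} [Group G] (σ : ℕ → G) (m n : ℕ) :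
    σ m * PiDown σ m n = ((List.range (n + 1)).map fun k => σ (m - k)).prod := by
  simp only [PiDown, List.range_succ_eq_map, List.map_cons, List.prod_cons, List.map_map,
    Nat.sub_zero]
  congr 3
  funext k
  simp only [Function.comp, Nat.sub_sub, Nat.succ_eq_add_one, Nat.add_comm 1]

theorem mul_PiUp {G : Type*} [Group G] (σ : ℕ → G) (m n : ℕ) :
    σ m * PiUp σ m n = ((List.range (n + 1)).map fun k => σ (m + k)).prod := by
  simp only [PiUp, List.range_succ_eq_map, List.map_cons, List.prod_cons, List.map_map,
    Nat.add_zero]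
  congr 3
  funext k
  simp only [Function.comp, Nat.add_assoc, Nat.succ_eq_add_one, Nat.add_comm 1]

theorem commute_PiUp {G : Type*} [Group G] {σ : ℕ → G} {m n : ℕ} {x : G}
    (h : ∀ k < n, Commute x (σ (m + 1 + k))) : Commute x (PiUp σ m n) := by
  refine Commute.list_prod_right _ _ fun y hy => ?_
  obtain ⟨k, hk, rfl⟩ := List.mem_map.mp hy
  exact h k (List.mem_range.mp hk)

theorem commute_PiDown {G : Type*} [Group G] {σ : ℕ → G} {m n : ℕ} {x : G}
    (h : ∀ k < n, Commute x (σ (m - 1 - k))) : Commute x (PiDown σ m n) := by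
  refine Commute.list_prod_right _ _ fun y hy => ?_
  obtain ⟨k, hk, rfl⟩ := List.mem_map.mp hy
  exact h k (List.mem_range.mp hk)

/-- The product of the last `n` hooks `σ m * Π′^m_k * Π^m_k`, `k = n - 1, …, 0`, of `Theta σ m`. -/
def hookProd {G : Type*} [Group G] (σ : ℕ → G) (m : ℕ) : ℕ → G
  | 0 => 1
  | n + 1 => σ m * PiDown σ m n * PiUp σ m n * hookProd σ m n

theorem hookProd_succ_eq {G : Type*} [Group G] (σ : ℕ → G) (m n : ℕ) :
    hookProd σ m (n + 1) = σ m * ((List.range n).map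
      (fun k => PiDown σ m (n - k) * PiUp σ m (n - k) * σ m)).prod := by
  induction n with
  | zero => simp [hookProd, PiDown, PiUp]
  | succ n ih =>
    rw [hookProd, ih, List.range_succ_eq_map]
    simp [Function.comp_def, mul_assoc]

theorem hookProd_eq_Theta {G : Type*} [Group G] (σ : ℕ → G) {m : ℕ} (hm : 1 ≤ m) :
    hookProd σ m m = Theta σ m := by
  obtain ⟨n, rfl⟩ := Nat.exists_eq_add_of_le' hm
  exact hookProd_succ_eq σ (n + 1) n

section BraidRelations

variable {G : Type*} [Group G] {m : ℕ} {σ : ℕ → G}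

theorem commute_hookProd
    (hcomm : ∀ i j, 1 ≤ i → j ≤ 2 * m - 1 → i + 2 ≤ j → Commute (σ i) (σ j))
    {n j : ℕ} (hn : n ≤ m) (hj : m + n < j) (hjm : j ≤ 2 * m - 1) :
    Commute (σ j) (hookProd σ m n) := by
  induction n with
  | zero => exact Commute.one_right _
  | succ n ih =>
    have h : ∀ i, 1 ≤ i → i ≤ m + n → Commute (σ j) (σ i) := fun i hi hin =>
      (hcomm i j hi hjm (by omega)).symm
    exact (((h m (by omega) (by omega)).mul_right
      (commute_PiDown fun k hk => h _ (by omega) (by omega))).mul_right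
      (commute_PiUp fun k hk => h _ (by omega) (by omega))).mul_right (ih (by omega) (by omega))

theorem semiconjBy_mul_PiDown
    (hcomm : ∀ i j, 1 ≤ i → j ≤ 2 * m - 1 → i + 2 ≤ j → Commute (σ i) (σ j))
    (hbraid : ∀ i, 1 ≤ i → i + 1 ≤ 2 * m - 1 →
      σ i * σ (i + 1) * σ i = σ (i + 1) * σ i * σ (i + 1))
    {n j : ℕ} (hn : n < m) (hj : m ≤ j + n) (hjm : j < m) :
    SemiconjBy (σ m * PiDown σ m n) (σ (j + 1)) (σ j) := by
  rw [mul_PiDown]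
  have h := semiconjBy_prod_range_of_braid (s := fun k => σ (m - k)) (n := n) (j := m - (j + 1))
    (fun a b hb hab => (hcomm _ _ (by omega) (by omega) (by omega)).symm)
    (fun a ha => by
      have h := hbraid (m - (a + 1)) (by omega) (by omega)
      rw [show m - (a + 1) + 1 = m - a by omega] at h
      exact h.symm) (by omega)
  rwa [show m - (m - (j + 1)) = j + 1 by omega,
    show m - (m - (j + 1) + 1) = j by omega] at h

/-- Two consecutive hooks move `σ (m - 1)` on the left to `σ (m + n + 1)` on the right. -/
theorem semiconjBy_hook_mul_hook
    (hcomm : ∀ i j, 1 ≤ i → j ≤ 2 * m - 1 → i + 2 ≤ j → Commute (σ i) (σ j))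
    (hbraid : ∀ i, 1 ≤ i → i + 1 ≤ 2 * m - 1 →
      σ i * σ (i + 1) * σ i = σ (i + 1) * σ i * σ (i + 1))
    {n : ℕ} (hn : n + 1 < m) :
    SemiconjBy (σ m * PiDown σ m (n + 1) * PiUp σ m (n + 1) *
      (σ m * PiDown σ m n * PiUp σ m n)) (σ (m + (n + 1))) (σ (m - 1)) := by
  have hdown := semiconjBy_mul_PiDown hcomm hbraid (n := n + 1) (j := m - 1) hn (by omega)
    (by omega)
  rw [show m - 1 + 1 = m by omega] at hdown
  have hDU : Commute (PiDown σ m n) (PiUp σ m n) := commute_PiUp fun k hk =>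
    (commute_PiDown fun l hl => (hcomm _ _ (by omega) (by omega) (by omega)).symm).symm
  have hD : Commute (PiDown σ m n) (σ (m + (n + 1))) :=
    (commute_PiDown fun l hl => (hcomm _ _ (by omega) (by omega) (by omega)).symm).symm
  have hup := semiconjBy_prod_range_prod_range_of_braid (s := fun k => σ (m + k)) (n := n + 1)
    (fun a b hb hab => hcomm _ _ (by omega) (by omega) (by omega))
    (fun a ha => hbraid (m + a) (by omega) (by omega))
  have hU : ((List.range (n + 1)).map fun k => σ (m + (k + 1))).prod = PiUp σ m (n + 1) := by
    simp only [PiUp, Nat.add_assoc, Nat.add_comm 1]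
  rw [hU, List.range_succ (n := n + 1), List.map_append, List.prod_append, List.map_singleton,
    List.prod_singleton, ← mul_PiUp] at hup
  have hV : σ m * PiUp σ m n * σ (m + (n + 1)) = σ m * PiUp σ m (n + 1) := by
    rw [mul_PiUp, mul_PiUp, List.range_succ (n := n + 1), List.map_append, List.prod_append,
      List.map_singleton, List.prod_singleton]
  have hpair : SemiconjBy (PiUp σ m (n + 1) * (σ m * PiUp σ m n)) (σ (m + (n + 1))) (σ m) := by
    rw [SemiconjBy, mul_assoc, ← hup.eq, hV, ← mul_assoc, ← mul_assoc, ← mul_assoc]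
  have hhook := (hdown.mul_left hpair).mul_left hD
  simpa only [mul_assoc, hDU.eq] using hhook

theorem semiconjBy_hookProd
    (hcomm : ∀ i j, 1 ≤ i → j ≤ 2 * m - 1 → i + 2 ≤ j → Commute (σ i) (σ j))
    (hbraid : ∀ i, 1 ≤ i → i + 1 ≤ 2 * m - 1 →
      σ i * σ (i + 1) * σ i = σ (i + 1) * σ i * σ (i + 1))
    {n i : ℕ} (hn : n ≤ m) (hi : 1 ≤ i) (hin : i < n) :
    SemiconjBy (hookProd σ m n) (σ (m + i)) (σ (m - n + i)) := by
  induction n with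
  | zero => omega
  | succ n ih =>
    rcases Nat.lt_succ_iff_lt_or_eq.mp hin with h | rfl
    · have hdown := semiconjBy_mul_PiDown hcomm hbraid (n := n) (j := m - (n + 1) + i)
        (by omega) (by omega) (by omega)
      rw [show m - (n + 1) + i + 1 = m - n + i by omega] at hdown
      exact (hdown.mul_left (commute_PiUp fun k hk =>
        hcomm _ _ (by omega) (by omega) (by omega)).symm).mul_left (ih (by omega) h)
    · obtain ⟨k, rfl⟩ := Nat.exists_eq_add_of_le' hi
      have hhook := semiconjBy_hook_mul_hook hcomm hbraid (n := k) (by omega)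
      have htail := commute_hookProd hcomm (n := k) (j := m + (k + 1)) (by omega) (by omega)
        (by omega)
      rw [show m - (k + 1 + 1) + (k + 1) = m - 1 by omega, hookProd, hookProd, ← mul_assoc]
      exact hhook.mul_left htail.symm

end BraidRelations

/-- The block-shift identity σ_i Θ_m = Θ_m σ_{m+i} for 1 ≤ i ≤ m−1. -/
theorem theta_block_shift {G : Type*} [Group G] (m : ℕ) (hm : 1 ≤ m)
    (σ : ℕ → G)
    (hcomm : ∀ i j, 1 ≤ i → j ≤ 2 * m - 1 → i + 2 ≤ j → σ i * σ j = σ j * σ i)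
    (hbraid : ∀ i, 1 ≤ i → i + 1 ≤ 2 * m - 1 →
      σ i * σ (i + 1) * σ i = σ (i + 1) * σ i * σ (i + 1)) :
    ∀ i, 1 ≤ i → i ≤ m - 1 →
      σ i * Theta σ m = Theta σ m * σ (m + i) := by
  intro i hi him
  have h := semiconjBy_hookProd hcomm hbraid le_rfl hi (by omega : i < m)
  rw [hookProd_eq_Theta σ hm, Nat.sub_self, Nat.zero_add] at h
  exact h.eq.symm
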